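/- Let φ : (0,∞) → (0,∞) be a C¹ function satisfying (φ₁)–(φ₃), let N ≥ 1, and let ρ : [0,∞) → [0,∞) be continuous and satisfy (A_ρ): ∫₁^∞ h⁻¹(𝒜_ρ(s)) ds = ∞, where 𝒜_ρ(s) = s^{1−N}·∫₀^s t^{N−1} ρ(t) dt. Let f : [0,∞) → [0,∞) be continuous, non-decreasing, with f(0) = 0 and f(s) > 0 for s > 0, and suppose f does NOT satisfy the φ-Keller–Osserman condition, i.e. ∫₁^∞ dt/Φ⁻¹(F(t)) = ∞, F(t) = ∫₀^t f. Then for every α > 0 there exists a radially symmetric u ∈ C¹(ℝᴺ), u > 0, with u(0) = α, which is a weak solution of Δ_φ u = ρ(|x|)·f(u) in ℝᴺ (i.e. ∫ φ(|∇u|)⟨∇u, ∇ψ⟩ dx + ∫ ρ(|x|) f(u) ψ dx = 0 for all ψ ∈ C_c^∞(ℝᴺ)) and satisfies u(x) → ∞ as |x| → ∞. -/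

import Mathlib

open MeasureTheory Real Set Filter RealInnerProductSpace

section Dilation

variable {E : Type*} [NormedAddCommGroup E] [NormedSpace ℝ E] [FiniteDimensional ℝ E]
  [MeasurableSpace E] [BorelSpace E] (μ : Measure E) [μ.IsAddHaarMeasure]

theorem hasDerivAt_integral_mul_comp_inv_smul {q ψ : E → ℝ} (hq : Continuous q)
    (hψ : ContDiff ℝ 1 ψ) (hc : HasCompactSupport ψ) {τ₀ : ℝ} (h₀ : 0 < τ₀) :
    HasDerivAt (fun τ : ℝ => ∫ y, q y * ψ (τ⁻¹ • y) ∂μ)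
      (∫ y, q y * (-τ₀⁻¹ * fderiv ℝ ψ (τ₀⁻¹ • y) (τ₀⁻¹ • y)) ∂μ) τ₀ := by
  have : ProperSpace E := FiniteDimensional.proper ℝ E
  obtain ⟨R, hR⟩ := hc.isCompact.isBounded.subset_closedBall (0 : E)
  have hD : Continuous fun x => fderiv ℝ ψ x x :=
    (hψ.continuous_fderiv (by norm_num)).clm_apply continuous_id
  have hzero : ∀ x, R < ‖x‖ → x ∉ tsupport ψ := fun x hx h => by
    have := hR h
    simp at this
    linarith
  have hfzero : ∀ x, R < ‖x‖ → fderiv ℝ ψ x x = 0 := fun x hx => by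
    have : fderiv ℝ ψ x = 0 := by
      by_contra hne
      exact hzero x hx (support_fderiv_subset ℝ hne)
    simp [this]
  obtain ⟨M, hM⟩ := (isCompact_closedBall (0 : E) R).exists_bound_of_continuousOn hD.continuousOn
  obtain ⟨Q, hQ⟩ := (isCompact_closedBall (0 : E) (2 * τ₀ * R)).exists_bound_of_continuousOn
    hq.continuousOn
  have key := hasDerivAt_integral_of_dominated_loc_of_deriv_le (μ := μ)
    (s := Ioo (τ₀ / 2) (2 * τ₀)) (x₀ := τ₀)
    (F := fun τ y => q y * ψ (τ⁻¹ • y))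
    (F' := fun τ y => q y * (-τ⁻¹ * fderiv ℝ ψ (τ⁻¹ • y) (τ⁻¹ • y)))
    (bound := (Metric.closedBall (0 : E) (2 * τ₀ * R)).indicator fun _ => Q * ((2 / τ₀) * M))
    (Ioo_mem_nhds (by linarith) (by linarith)) ?_ ?_ ?_ ?_ ?_ ?_
  · exact key.2
  · exact Eventually.of_forall fun τ => by
      have := hψ.continuous
      exact Continuous.aestronglyMeasurable (by fun_prop)
  · refine Continuous.integrable_of_hasCompactSupport (by have := hψ.continuous; fun_prop) ?_
    exact (hc.comp_smul (inv_ne_zero h₀.ne')).mul_left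
  · exact Continuous.aestronglyMeasurable
      (hq.mul (continuous_const.mul (hD.comp (continuous_const_smul τ₀⁻¹))))
  · refine Eventually.of_forall fun y τ hτ => ?_
    have hτ0 : 0 < τ := by linarith [hτ.1]
    by_cases hy : R < ‖τ⁻¹ • y‖
    · rw [hfzero _ hy]
      simp only [mul_zero, norm_zero]
      refine indicator_nonneg (fun z hz => ?_) y
      have hb : (0 : E) ∈ Metric.closedBall (0 : E) R := by
        have : 0 ≤ 2 * τ₀ * R := (norm_nonneg z).trans (by simpa using hz)
        have : 0 ≤ R := by by_contra hneg; nlinarith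
        simpa
      have := (norm_nonneg _).trans (hM 0 hb)
      have := (norm_nonneg _).trans (hQ z hz)
      positivity
    · push Not at hy
      have hyb : y ∈ Metric.closedBall (0 : E) (2 * τ₀ * R) := by
        have hR0 : 0 ≤ R := (norm_nonneg _).trans hy
        rw [norm_smul, norm_inv, Real.norm_of_nonneg hτ0.le, inv_mul_le_iff₀ hτ0] at hy
        rw [mem_closedBall_zero_iff]
        nlinarith [hτ.2]
      rw [indicator_of_mem hyb, norm_mul, norm_mul, norm_neg, norm_inv, Real.norm_of_nonneg hτ0.le]
      have h1 := hQ y hyb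
      have h2 := hM (τ⁻¹ • y) (by simpa using hy)
      have h3 : τ⁻¹ ≤ 2 / τ₀ := by
        rw [inv_le_comm₀ hτ0 (by positivity), inv_div]; exact hτ.1.le
      gcongr
      exact (norm_nonneg _).trans h1
  · exact (integrable_indicator_iff measurableSet_closedBall).2
      (integrableOn_const (isCompact_closedBall _ _).measure_ne_top)
  · refine Eventually.of_forall fun y τ hτ => ?_
    have hτ0 : τ ≠ 0 := by linarith [hτ.1]
    have h1 : HasDerivAt (fun τ : ℝ => τ⁻¹ • y) (-(τ ^ 2)⁻¹ • y) τ :=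
      (hasDerivAt_inv hτ0).smul_const y
    have h2 := ((hψ.differentiable (by norm_num)) (τ⁻¹ • y)).hasFDerivAt.comp_hasDerivAt τ h1
    refine (h2.const_mul (q y)).congr_deriv ?_
    simp only [map_smul, smul_eq_mul]
    field_simp

theorem integral_mul_comp_inv_smul {q g : E → ℝ} {τ : ℝ} (hτ : 0 < τ) :
    ∫ y, q y * g (τ⁻¹ • y) ∂μ = τ ^ Module.finrank ℝ E * ∫ x, q (τ • x) * g x ∂μ := by
  have h := Measure.integral_comp_smul μ (fun y => q y * g (τ⁻¹ • y)) τ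
  simp only [smul_smul, inv_mul_cancel₀ hτ.ne', one_smul, smul_eq_mul] at h
  rw [h, abs_of_pos (by positivity), ← mul_assoc, mul_inv_cancel₀ (by positivity), one_mul]

theorem integral_dilation_mean_mul_fderiv {q ψ : E → ℝ} (hd : 1 ≤ Module.finrank ℝ E)
    (hq : Continuous q) (hψ : ContDiff ℝ 1 ψ) (hc : HasCompactSupport ψ) :
    ∫ x, (∫ τ in (0 : ℝ)..1, τ ^ (Module.finrank ℝ E - 1) * q (τ • x)) * fderiv ℝ ψ x x ∂μ =
      -∫ x, q x * ψ x ∂μ := by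
  have : ProperSpace E := FiniteDimensional.proper ℝ E
  set d := Module.finrank ℝ E with hdd
  have hD : Continuous fun x => fderiv ℝ ψ x x :=
    (hψ.continuous_fderiv (by norm_num)).clm_apply continuous_id
  have hψc := hψ.continuous
  have hDzero : ∀ x, x ∉ tsupport ψ → fderiv ℝ ψ x x = 0 := fun x hx => by
    have : fderiv ℝ ψ x = 0 := by
      by_contra hne
      exact hx (support_fderiv_subset ℝ hne)
    simp [this]
  have hJ : Continuous fun τ : ℝ => τ ^ (d - 1) * ∫ x, q (τ • x) * fderiv ℝ ψ x x ∂μ := by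
    refine (continuous_id.pow _).mul (continuousOn_univ.1
      (continuousOn_integral_of_compact_support (k := tsupport ψ) hc ?_ ?_))
    · refine Continuous.continuousOn ?_
      exact (hq.comp (continuous_fst.smul continuous_snd)).mul (hD.comp continuous_snd)
    · intro τ x _ hx
      simp [hDzero x hx]
  have hI : Continuous fun τ : ℝ => τ ^ d * ∫ x, q (τ • x) * ψ x ∂μ := by
    refine (continuous_id.pow _).mul (continuousOn_univ.1
      (continuousOn_integral_of_compact_support (k := tsupport ψ) hc ?_ ?_))
    · refine Continuous.continuousOn ?_
      exact (hq.comp (continuous_fst.smul continuous_snd)).mul (hψc.comp continuous_snd)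
    · intro τ x _ hx
      simp [image_eq_zero_of_notMem_tsupport hx]
  have hderiv : ∀ τ ∈ Ioo (0 : ℝ) 1, HasDerivAt (fun τ : ℝ => τ ^ d * ∫ x, q (τ • x) * ψ x ∂μ)
      (-(τ ^ (d - 1) * ∫ x, q (τ • x) * fderiv ℝ ψ x x ∂μ)) τ := by
    intro τ hτ
    have h := hasDerivAt_integral_mul_comp_inv_smul μ hq hψ hc hτ.1
    rw [integral_mul_comp_inv_smul (q := q) (g := fun x => -τ⁻¹ * fderiv ℝ ψ x x) μ hτ.1] at h
    refine (h.congr_of_eventuallyEq ?_).congr_deriv ?_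
    · filter_upwards [lt_mem_nhds hτ.1] with σ hσ
      rw [integral_mul_comp_inv_smul μ hσ]
    · have : ∀ x, q (τ • x) * (-τ⁻¹ * fderiv ℝ ψ x x) =
          -τ⁻¹ * (q (τ • x) * fderiv ℝ ψ x x) := fun x => by ring
      simp_rw [this, integral_const_mul]
      rw [← hdd, ← mul_assoc]
      have : τ ^ d = τ ^ (d - 1) * τ := by rw [← pow_succ]; congr; omega
      rw [this]
      have := hτ.1.ne'
      field_simp
  have hftc := intervalIntegral.integral_eq_sub_of_hasDerivAt_of_le zero_le_one
    hI.continuousOn hderiv (hJ.neg.intervalIntegrable 0 1)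
  simp only [one_pow, one_smul, one_mul, zero_pow (by omega : d ≠ 0), zero_mul, sub_zero,
    intervalIntegral.integral_neg] at hftc
  rw [← hftc, neg_neg]
  have hint : Integrable (Function.uncurry fun (τ : ℝ) (x : E) =>
      τ ^ (d - 1) * q (τ • x) * fderiv ℝ ψ x x) ((volume.restrict (uIoc (0 : ℝ) 1)).prod μ) := by
    have hcont : Continuous (Function.uncurry fun (τ : ℝ) (x : E) =>
        τ ^ (d - 1) * q (τ • x) * fderiv ℝ ψ x x) :=
      ((continuous_fst.pow _).mul (hq.comp (continuous_fst.smul continuous_snd))).mul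
        (hD.comp continuous_snd)
    have h1 : IntegrableOn (Function.uncurry fun (τ : ℝ) (x : E) =>
        τ ^ (d - 1) * q (τ • x) * fderiv ℝ ψ x x) (Icc (0 : ℝ) 1 ×ˢ tsupport ψ)
        (volume.prod μ) :=
      hcont.continuousOn.integrableOn_compact (isCompact_Icc.prod hc)
    have h2 : IntegrableOn (Function.uncurry fun (τ : ℝ) (x : E) =>
        τ ^ (d - 1) * q (τ • x) * fderiv ℝ ψ x x) (uIoc (0 : ℝ) 1 ×ˢ univ) (volume.prod μ) := by
      refine h1.of_forall_sdiff_eq_zero (measurableSet_uIoc.prod .univ) ?_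
      rintro ⟨τ, x⟩ ⟨⟨hτ, -⟩, hn⟩
      have : x ∉ tsupport ψ := fun h => hn ⟨by
        rw [uIoc_of_le zero_le_one] at hτ; exact Ioc_subset_Icc_self hτ, h⟩
      simp [hDzero x this]
    rwa [IntegrableOn, ← Measure.prod_restrict, Measure.restrict_univ] at h2
  have hswap := intervalIntegral_integral_swap hint
  simp_rw [intervalIntegral.integral_mul_const] at hswap
  rw [← hswap]
  refine intervalIntegral.integral_congr fun τ _ => ?_
  simp only [mul_assoc, integral_const_mul]

end Dilation

section Radial

variable {E : Type*} [NormedAddCommGroup E] [InnerProductSpace ℝ E] [CompleteSpace E]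

theorem hasGradientAt_radial {W W' : ℝ → ℝ} (hW : ∀ r, HasDerivAt W (W' r) r) (h0 : W' 0 = 0)
    (x : E) : HasGradientAt (fun y : E => W ‖y‖) ((W' ‖x‖ / ‖x‖) • x) x := by
  rcases eq_or_ne x 0 with rfl | hx
  · have h := hW 0
    rw [h0, hasDerivAt_iff_isLittleO_nhds_zero] at h
    rw [hasGradientAt_iff_isLittleO]
    have ht : Tendsto (fun y : E => ‖y‖) (nhds 0) (nhds 0) := by
      simpa using (continuous_norm (E := E)).tendsto 0
    have h2 := h.comp_tendsto ht
    simp only [Function.comp_def, zero_add, smul_zero, sub_zero] at h2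
    simpa using h2.of_norm_right
  · have hn : HasGradientAt (fun y : E => ‖y‖) (‖x‖⁻¹ • x) x := by
      have h1 : HasFDerivAt (fun y : E => ‖y‖ ^ 2) (2 • innerSL ℝ x) x :=
        (hasStrictFDerivAt_norm_sq x).hasFDerivAt
      have h2 := h1.sqrt (by simpa using hx)
      simp only [Real.sqrt_sq (norm_nonneg _)] at h2
      rw [hasGradientAt_iff_hasFDerivAt]
      refine h2.congr_fderiv ?_
      ext y
      simp
      field_simp
    rw [hasGradientAt_iff_hasFDerivAt] at hn ⊢
    refine ((hW ‖x‖).comp_hasFDerivAt x hn).congr_fderiv ?_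
    simp only [div_eq_mul_inv, mul_smul, map_smul]

theorem contDiff_one_radial {W W' : ℝ → ℝ} (hW : ∀ r, HasDerivAt W (W' r) r)
    (hW' : Continuous W') (h0 : W' 0 = 0) : ContDiff ℝ 1 (fun y : E => W ‖y‖) := by
  refine contDiff_one_iff_hasFDerivAt.2
    ⟨fun x => InnerProductSpace.toDual ℝ E ((W' ‖x‖ / ‖x‖) • x), ?_,
      fun x => (hasGradientAt_radial hW h0 x).hasFDerivAt⟩
  refine (InnerProductSpace.toDual ℝ E).continuous.comp ?_
  rw [continuous_iff_continuousAt]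
  intro x
  rcases eq_or_ne x 0 with rfl | hx
  · have ht : Tendsto (fun y : E => |W' ‖y‖|) (nhds 0) (nhds 0) := by
      have : Continuous fun y : E => |W' ‖y‖| := by fun_prop
      simpa [h0] using this.tendsto 0
    simp only [ContinuousAt, norm_zero, smul_zero]
    refine squeeze_zero_norm (fun y => ?_) ht
    rw [norm_smul, norm_div, norm_norm, Real.norm_eq_abs]
    rcases eq_or_ne y 0 with rfl | hy
    · simp
    · rw [div_mul_cancel₀ _ (norm_ne_zero_iff.2 hy)]
  · have hx' : ‖x‖ ≠ 0 := norm_ne_zero_iff.2 hx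
    exact ((hW'.comp continuous_norm).continuousAt.div continuous_norm.continuousAt hx').smul
      continuousAt_id

end Radial

section Volterra

/-- The average of `q` over a ball, up to a constant: for `s ≠ 0` this is
`s ^ (-N) * ∫ t in 0..s, t ^ (N - 1) * q t`. -/
noncomputable def dilationMean (N : ℕ) (q : ℝ → ℝ) (s : ℝ) : ℝ :=
  ∫ τ in (0 : ℝ)..1, τ ^ (N - 1) * q (τ * s)

theorem continuous_dilationMean (N : ℕ) {q : ℝ → ℝ} (hq : Continuous q) :
    Continuous (dilationMean N q) := by
  unfold dilationMean
  refine intervalIntegral.continuous_parametric_intervalIntegral_of_continuous' ?_ 0 1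
  fun_prop

theorem dilationMean_mono (N : ℕ) {q₁ q₂ : ℝ → ℝ} (h₁ : Continuous q₁) (h₂ : Continuous q₂) {s : ℝ}
    (hs : 0 ≤ s) (h : ∀ t ∈ Icc 0 s, q₁ t ≤ q₂ t) : dilationMean N q₁ s ≤ dilationMean N q₂ s := by
  refine intervalIntegral.integral_mono_on zero_le_one
    (Continuous.intervalIntegrable (by fun_prop) _ _)
    (Continuous.intervalIntegrable (by fun_prop) _ _) fun τ hτ => ?_
  exact mul_le_mul_of_nonneg_left (h _ ⟨mul_nonneg hτ.1 hs, mul_le_of_le_one_left hs hτ.2⟩)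
    (pow_nonneg hτ.1 _)

theorem dilationMean_const_mul (N : ℕ) (c : ℝ) (q : ℝ → ℝ) (s : ℝ) :
    dilationMean N (fun t => c * q t) s = c * dilationMean N q s := by
  unfold dilationMean
  rw [← intervalIntegral.integral_const_mul]
  congr 1 with τ
  ring

theorem dilationMean_congr (N : ℕ) {q₁ q₂ : ℝ → ℝ} {s : ℝ}
    (hs : 0 ≤ s) (h : ∀ t, 0 ≤ t → q₁ t = q₂ t) : dilationMean N q₁ s = dilationMean N q₂ s := by
  refine intervalIntegral.integral_congr fun τ hτ => ?_
  rw [uIcc_of_le zero_le_one] at hτ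
  simp only [h _ (mul_nonneg hτ.1 hs)]

theorem dilationMean_nonneg (N : ℕ) {q : ℝ → ℝ} {s : ℝ}
    (hs : 0 ≤ s) (h : ∀ t, 0 ≤ t → 0 ≤ q t) : 0 ≤ dilationMean N q s :=
  intervalIntegral.integral_nonneg zero_le_one fun _ hτ =>
    mul_nonneg (pow_nonneg hτ.1 _) (h _ (mul_nonneg hτ.1 hs))

theorem dilationMean_le_of_le (N : ℕ) {q : ℝ → ℝ} (hq : Continuous q) {s C : ℝ} (hs : 0 ≤ s)
    (h0 : ∀ t, 0 ≤ t → 0 ≤ q t) (h : ∀ t ∈ Icc 0 s, q t ≤ C) : dilationMean N q s ≤ C := by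
  have : ∫ _ in (0 : ℝ)..1, C = C := by simp
  rw [← this]
  refine intervalIntegral.integral_mono_on zero_le_one
    (Continuous.intervalIntegrable (by fun_prop) _ _)
    (Continuous.intervalIntegrable (by fun_prop) _ _) fun τ hτ => ?_
  have hm : τ * s ∈ Icc 0 s := ⟨mul_nonneg hτ.1 hs, mul_le_of_le_one_left hs hτ.2⟩
  calc τ ^ (N - 1) * q (τ * s) ≤ 1 * q (τ * s) :=
        mul_le_mul_of_nonneg_right (pow_le_one₀ hτ.1 hτ.2) (h0 _ hm.1)
    _ ≤ C := by rw [one_mul]; exact h _ hm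

theorem pow_mul_dilationMean {N : ℕ} (hN : 1 ≤ N) (q : ℝ → ℝ) {s : ℝ} (hs : 0 < s) :
    s ^ N * dilationMean N q s = ∫ t in (0 : ℝ)..s, t ^ (N - 1) * q t := by
  have h := intervalIntegral.integral_comp_mul_right (a := 0) (b := 1)
    (fun t => t ^ (N - 1) * q t) hs.ne'
  simp only [zero_mul, one_mul, smul_eq_mul, mul_pow] at h
  rw [eq_inv_mul_iff_mul_eq₀ hs.ne'] at h
  rw [← h, dilationMean, ← intervalIntegral.integral_const_mul, ← intervalIntegral.integral_const_mul]
  congr 1 with τ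
  obtain ⟨k, rfl⟩ : ∃ k, N = k + 1 := ⟨N - 1, by omega⟩
  simp only [Nat.add_sub_cancel]
  ring

theorem mul_dilationMean_le_integral (N : ℕ) {q : ℝ → ℝ} (hq : Continuous q) {s : ℝ} (hs : 0 ≤ s)
    (h0 : ∀ t, 0 ≤ t → 0 ≤ q t) : s * dilationMean N q s ≤ ∫ t in (0 : ℝ)..s, q t := by
  have h := intervalIntegral.smul_integral_comp_mul_right (a := 0) (b := 1) q s
  simp only [zero_mul, one_mul, smul_eq_mul] at h
  rw [← h]
  refine mul_le_mul_of_nonneg_left ?_ hs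
  refine intervalIntegral.integral_mono_on zero_le_one
    (Continuous.intervalIntegrable (by fun_prop) _ _)
    (Continuous.intervalIntegrable (by fun_prop) _ _) fun τ hτ => ?_
  exact mul_le_of_le_one_left (h0 _ (mul_nonneg hτ.1 hs)) (pow_le_one₀ hτ.1 hτ.2)

/-- The integral operator whose fixed points are the radial solutions with value `α` at the
origin, frozen to the constant `α` on the negative half-line. -/
noncomputable def radialOperator (N : ℕ) (η f ρ : ℝ → ℝ) (α : ℝ) (v : ℝ → ℝ) (r : ℝ) : ℝ :=
  α + ∫ s in (0 : ℝ)..max r 0, η (s * dilationMean N (fun t => ρ t * f (v t)) s)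

variable {N : ℕ} {η f ρ v v₁ v₂ : ℝ → ℝ} {α : ℝ}

theorem continuous_radialIntegrand (hη : Continuous η) (hf : Continuous f) (hρ : Continuous ρ)
    (hv : Continuous v) :
    Continuous fun s => η (s * dilationMean N (fun t => ρ t * f (v t)) s) :=
  hη.comp (continuous_id.mul (continuous_dilationMean N (hρ.mul (hf.comp hv))))

theorem continuous_radialOperator (hη : Continuous η) (hf : Continuous f) (hρ : Continuous ρ)
    (hv : Continuous v) : Continuous (radialOperator N η f ρ α v) := by
  have h := continuous_radialIntegrand (N := N) hη hf hρ hv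
  exact continuous_const.add ((intervalIntegral.continuous_primitive
    (fun a b => h.intervalIntegrable a b) 0).comp (continuous_id.max continuous_const))

theorem le_radialOperator (hη0 : ∀ y, 0 ≤ η y) (r : ℝ) : α ≤ radialOperator N η f ρ α v r :=
  le_add_of_nonneg_right (intervalIntegral.integral_nonneg (le_max_right _ _) fun _ _ => hη0 _)

theorem radialOperator_mono (hη : Continuous η) (hf : Continuous f) (hρ : Continuous ρ)
    (hηm : Monotone η) (hfm : Monotone f) (hρ0 : ∀ r, 0 ≤ ρ r)
    (h₁ : Continuous v₁) (h₂ : Continuous v₂) (h : ∀ r, v₁ r ≤ v₂ r) (r : ℝ) :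
    radialOperator N η f ρ α v₁ r ≤ radialOperator N η f ρ α v₂ r := by
  refine add_le_add_right (intervalIntegral.integral_mono_on (le_max_right _ _)
    ((continuous_radialIntegrand hη hf hρ h₁).intervalIntegrable _ _)
    ((continuous_radialIntegrand hη hf hρ h₂).intervalIntegrable _ _) fun s hs => ?_) α
  refine hηm (mul_le_mul_of_nonneg_left (dilationMean_mono N (hρ.mul (hf.comp h₁))
    (hρ.mul (hf.comp h₂)) hs.1 fun t _ => ?_) hs.1)
  exact mul_le_mul_of_nonneg_left (hfm (h t)) (hρ0 t)

/-- Monotone iteration: an a priori bound for the subsolutions `v ≤ T v` of the radial operator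
yields a fixed point. -/
theorem exists_fixedPoint_radialOperator (hη : Continuous η) (hf : Continuous f)
    (hρ : Continuous ρ) (hηm : Monotone η) (hfm : Monotone f) (hρ0 : ∀ r, 0 ≤ ρ r)
    (hη0 : ∀ y, 0 ≤ η y) (hf0 : ∀ y, 0 ≤ f y)
    (hbound : ∀ R, 0 < R → ∃ B, ∀ v : ℝ → ℝ, Continuous v → (∀ r, α ≤ v r) →
      (∀ r, v r ≤ radialOperator N η f ρ α v r) → ∀ r ≤ R, v r ≤ B) :
    ∃ w : ℝ → ℝ, Continuous w ∧ (∀ r, α ≤ w r) ∧ ∀ r, w r = radialOperator N η f ρ α w r := by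
  let V : ℕ → ℝ → ℝ := fun n => (radialOperator N η f ρ α)^[n] fun _ => α
  have hVsucc : ∀ n, V (n + 1) = radialOperator N η f ρ α (V n) := fun n =>
    Function.iterate_succ_apply' _ _ _
  have hVc : ∀ n, Continuous (V n) := fun n => by
    induction n with
    | zero => exact continuous_const
    | succ n ih => rw [hVsucc]; exact continuous_radialOperator hη hf hρ ih
  have hVα : ∀ n r, α ≤ V n r := fun n r => by
    cases n with
    | zero => exact le_rfl
    | succ n => rw [hVsucc]; exact le_radialOperator hη0 r
  have hVstep : ∀ n r, V n r ≤ V (n + 1) r := fun n => by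
    induction n with
    | zero => exact fun r => hVα 1 r
    | succ n ih =>
      rw [hVsucc, hVsucc]
      exact radialOperator_mono hη hf hρ hηm hfm hρ0 (hVc n) (hVc (n + 1)) ih
  have hVbound : ∀ R, 0 < R → ∃ B, ∀ n, ∀ r ≤ R, V n r ≤ B := fun R hR => by
    obtain ⟨B, hB⟩ := hbound R hR
    exact ⟨B, fun n => hB (V n) (hVc n) (hVα n) fun r => by rw [← hVsucc]; exact hVstep n r⟩
  have hlim : ∀ r, ∃ L, Tendsto (fun n => V n r) atTop (nhds L) := fun r => by
    obtain ⟨B, hB⟩ := hVbound (max r 1) (by positivity)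
    exact ⟨_, tendsto_atTop_ciSup (monotone_nat_of_le_succ fun n => hVstep n r)
      ⟨B, by rintro _ ⟨n, rfl⟩; exact hB n r (le_max_left _ _)⟩⟩
  choose w hw using hlim
  have hwα : ∀ r, α ≤ w r := fun r => ge_of_tendsto' (hw r) fun n => hVα n r
  -- uniform bound of the integrands on `[0, R]`
  have hG : ∀ R, 0 < R → ∃ Q L, 0 ≤ L ∧ ∀ n, (∀ s ∈ Icc 0 R, ρ s * f (V n s) ≤ Q) ∧
      ∀ s ∈ Icc 0 R, η (s * dilationMean N (fun t => ρ t * f (V n t)) s) ≤ L := fun R hR => by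
    obtain ⟨B, hB⟩ := hVbound R hR
    obtain ⟨M, hM⟩ := isCompact_Icc.exists_bound_of_continuousOn (hρ.continuousOn (s := Icc 0 R))
    have hQ : ∀ n, ∀ s ∈ Icc 0 R, ρ s * f (V n s) ≤ M * f B := fun n s hs =>
      mul_le_mul ((le_abs_self _).trans (hM s hs)) (hfm (hB n s hs.2)) (hf0 _)
        ((norm_nonneg _).trans (hM s hs))
    refine ⟨M * f B, η (R * (M * f B)), hη0 _, fun n => ⟨hQ n, fun s hs => hηm ?_⟩⟩
    refine mul_le_mul hs.2 (dilationMean_le_of_le N (hρ.mul (hf.comp (hVc n))) hs.1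
      (fun t _ => mul_nonneg (hρ0 _) (hf0 _))
      fun t ht => hQ n t ⟨ht.1, ht.2.trans hs.2⟩) ?_ hR.le
    exact dilationMean_nonneg N hs.1 fun t _ => mul_nonneg (hρ0 _) (hf0 _)
  have hLip : ∀ R, 0 < R → ∃ L, 0 ≤ L ∧ ∀ a b, a ≤ b → b ≤ R → |w b - w a| ≤ L * (b - a) :=
    fun R hR => by
    obtain ⟨Q, L, hL0, hL⟩ := hG R hR
    refine ⟨L, hL0, fun a b hab hbR => ?_⟩
    refine le_of_tendsto' (((hw b).sub (hw a)).abs.comp (tendsto_add_atTop_nat 1)) fun n => ?_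
    have hI := continuous_radialIntegrand (N := N) hη hf hρ (hVc n)
    simp only [Function.comp_apply, hVsucc, radialOperator, add_sub_add_left_eq_sub]
    rw [intervalIntegral.integral_interval_sub_left (hI.intervalIntegrable _ _)
      (hI.intervalIntegrable _ _), ← Real.norm_eq_abs]
    have hm : max a 0 ≤ max b 0 := max_le_max_right 0 hab
    refine (intervalIntegral.norm_integral_le_of_norm_le_const (C := L) fun s hs => ?_).trans ?_
    · rw [uIoc_of_le hm] at hs
      rw [Real.norm_of_nonneg (hη0 _)]
      exact (hL n).2 s ⟨(le_max_right _ _).trans hs.1.le, hs.2.trans (max_le hbR hR.le)⟩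
    · refine mul_le_mul_of_nonneg_left ?_ hL0
      refine (abs_max_sub_max_le_abs b a 0).trans ?_
      rw [abs_of_nonneg (by linarith)]
  have hwc : Continuous w := by
    rw [continuous_iff_continuousAt]
    intro r
    obtain ⟨L, hL0, hL⟩ := hLip (|r| + 1) (by positivity)
    refine continuousAt_of_locally_lipschitz (r := 1) one_pos L fun y hy => ?_
    rw [Real.dist_eq] at hy
    have hr := le_abs_self r
    have := le_abs_self (y - r)
    rw [Real.dist_eq, Real.dist_eq]
    rcases le_total y r with h | h
    · rw [abs_sub_comm, abs_sub_comm y, abs_of_nonneg (sub_nonneg.2 h)]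
      exact hL y r h (by linarith)
    · rw [abs_of_nonneg (sub_nonneg.2 h)]
      exact hL r y h (by linarith)
  refine ⟨w, hwc, hwα, fun r => ?_⟩
  refine tendsto_nhds_unique ((hw r).comp (tendsto_add_atTop_nat 1)) ?_
  simp only [Function.comp_def, hVsucc, radialOperator]
  obtain ⟨Q, L, hL0, hL⟩ := hG (max r 1) (by positivity)
  refine tendsto_const_nhds.add (intervalIntegral.tendsto_integral_filter_of_dominated_convergence
    (fun _ => L) (Eventually.of_forall fun n =>
      (continuous_radialIntegrand hη hf hρ (hVc n)).aestronglyMeasurable) ?_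
    intervalIntegrable_const ?_)
  · refine Eventually.of_forall fun n => Eventually.of_forall fun s hs => ?_
    rw [uIoc_of_le (le_max_right _ _)] at hs
    rw [Real.norm_of_nonneg (hη0 _)]
    exact (hL n).2 s ⟨hs.1.le, hs.2.trans (max_le_max_left r zero_le_one)⟩
  · refine Eventually.of_forall fun s hs => ?_
    rw [uIoc_of_le (le_max_right _ _)] at hs
    refine (hη.tendsto _).comp (tendsto_const_nhds.mul ?_)
    refine intervalIntegral.tendsto_integral_filter_of_dominated_convergence
      (fun _ => Q) (Eventually.of_forall fun n => ?_) ?_ intervalIntegrable_const ?_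
    · have := hVc n
      exact Continuous.aestronglyMeasurable (by fun_prop)
    · refine Eventually.of_forall fun n => Eventually.of_forall fun τ hτ => ?_
      rw [uIoc_of_le zero_le_one] at hτ
      have hnn : 0 ≤ ρ (τ * s) * f (V n (τ * s)) := mul_nonneg (hρ0 _) (hf0 _)
      rw [Real.norm_of_nonneg (mul_nonneg (pow_nonneg hτ.1.le _) hnn)]
      refine (mul_le_of_le_one_left hnn (pow_le_one₀ hτ.1.le hτ.2)).trans ((hL n).1 _ ?_)
      exact ⟨mul_nonneg hτ.1.le hs.1.le, (mul_le_of_le_one_left hs.1.le hτ.2).trans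
        (hs.2.trans (max_le_max_left r zero_le_one))⟩
    · exact Eventually.of_forall fun τ _ => tendsto_const_nhds.mul
        (tendsto_const_nhds.mul ((hf.tendsto _).comp (hw _)))

end Volterra

section Bound

theorem exists_lt_integral_of_not_integrableOn {p : ℝ → ℝ} {a : ℝ} (hp : ContinuousOn p (Ici a))
    (h0 : ∀ t, a ≤ t → 0 ≤ p t) (h : ¬ IntegrableOn p (Ioi a)) (M : ℝ) :
    ∃ T, a ≤ T ∧ M < ∫ t in a..T, p t := by
  by_contra! hcon
  refine h (integrableOn_Ioi_of_intervalIntegral_norm_bounded (l := atTop) (b := id) M a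
    (fun T => ((hp.mono Icc_subset_Ici_self).integrableOn_Icc (b := T)).mono_set
      Ioc_subset_Icc_self) tendsto_id ?_)
  filter_upwards [eventually_ge_atTop a] with T hT
  refine le_trans (le_of_eq ?_) (hcon T hT)
  refine intervalIntegral.integral_congr fun t ht => ?_
  simp only [id] at ht
  rw [uIcc_of_le hT] at ht
  exact Real.norm_of_nonneg (h0 t ht.1)

variable {h η : ℝ → ℝ}

theorem strictMonoOn_primitive (hh : Continuous h) (hpos : ∀ t, 0 < t → 0 < h t) :
    StrictMonoOn (fun t => ∫ s in (0 : ℝ)..t, h s) (Ici 0) := by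
  intro a ha b _ hab
  rw [← sub_pos, intervalIntegral.integral_interval_sub_left (hh.intervalIntegrable _ _)
    (hh.intervalIntegrable _ _)]
  exact intervalIntegral.intervalIntegral_pos_of_pos_on (hh.intervalIntegrable _ _)
    (fun x hx => hpos x (lt_of_le_of_lt ha hx.1)) hab

theorem mul_primitive_le (hh : Continuous h) (hm : Monotone h) {K t : ℝ} (hK : 1 ≤ K)
    (ht : 0 ≤ t) : K * ∫ s in (0 : ℝ)..t, h s ≤ ∫ s in (0 : ℝ)..(K * t), h s := by
  have e := intervalIntegral.mul_integral_comp_mul_left (a := 0) (b := t) (f := h) K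
  rw [mul_zero] at e
  rw [← e]
  refine mul_le_mul_of_nonneg_left (intervalIntegral.integral_mono_on ht
    (hh.intervalIntegrable _ _) (Continuous.intervalIntegrable (by fun_prop) _ _)
    fun s hs => hm (le_mul_of_one_le_left hs.1 hK)) (by linarith)

/-- The derivative of the Legendre transform of a primitive of `h` is the inverse of `h`. -/
theorem hasDerivAt_legendre (hh : Continuous h) (hη : Continuous η)
    (hhη : ∀ y, 0 ≤ y → h (η y) = y) {y d : ℝ} (hy : 0 < y) (hd : HasDerivAt h d (η y))
    (hd0 : d ≠ 0) :
    HasDerivAt (fun y => y * η y - ∫ s in (0 : ℝ)..η y, h s) (η y) y := by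
  have h1 : HasDerivAt η d⁻¹ y := hd.of_local_left_inverse hη.continuousAt hd0 (by
    filter_upwards [lt_mem_nhds hy] with z hz using hhη z hz.le)
  have h2 : HasDerivAt (fun t => ∫ s in (0 : ℝ)..t, h s) (h (η y)) (η y) :=
    intervalIntegral.integral_hasDerivAt_right (hh.intervalIntegrable _ _)
      hh.stronglyMeasurable.stronglyMeasurableAtFilter hh.continuousAt
  refine (((hasDerivAt_id y).mul h1).sub (h2.comp y h1)).congr_deriv ?_
  rw [hhη y hy.le]
  simp

variable {N : ℕ} {Φi f ρ : ℝ → ℝ} {α l : ℝ}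

/-- If `v` is below the solution `z` of `h(z') = ∫ C f(v)`, then `z' ≤ K Φ⁻¹(F(z))`. -/
theorem deriv_le_of_energy (hh : Continuous h) (hhm : Monotone h) (hh0 : h 0 = 0)
    (hhpos : ∀ t, 0 < t → 0 < h t) (hd : ∀ t, 0 < t → ∃ d, d ≠ 0 ∧ HasDerivAt h d t)
    (hη : Continuous η) (hη0 : ∀ y, 0 ≤ η y) (hhη : ∀ y, 0 ≤ y → h (η y) = y)
    (hl : 1 < l) (hlΦ : ∀ t, 0 ≤ t → l * ∫ s in (0 : ℝ)..t, h s ≤ t * h t)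
    (hΦi0 : ∀ y, 0 ≤ y → 0 ≤ Φi y) (hΦi : ∀ y, 0 ≤ y → ∫ s in (0 : ℝ)..Φi y, h s = y)
    (hf : Continuous f) (hfm : Monotone f) (hf0 : ∀ y, 0 ≤ f y) (hfpos : ∀ y, 0 < y → 0 < f y)
    {v z : ℝ → ℝ} {C K R : ℝ} (hα : 0 < α) (hC : 0 < C) (hK1 : 1 ≤ K) (hK : C ≤ (l - 1) * K)
    (hv : Continuous v) (hvα : ∀ r, α ≤ v r) (hz0 : z 0 = α)
    (hz : ∀ s, HasDerivAt z (η (∫ t in (0 : ℝ)..s, C * f (v t))) s)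
    (hvz : ∀ s ∈ Icc 0 R, v s ≤ z s) {s : ℝ} (hs : s ∈ Icc 0 R) :
    η (∫ t in (0 : ℝ)..s, C * f (v t)) ≤ K * Φi (∫ t in (0 : ℝ)..z s, f t) := by
  have hgc : Continuous fun t => C * f (v t) := by fun_prop
  have hgpos : ∀ t, 0 < C * f (v t) := fun t => mul_pos hC (hfpos _ (hα.trans_le (hvα t)))
  set G : ℝ → ℝ := fun s => ∫ t in (0 : ℝ)..s, C * f (v t) with hG
  have hGd : ∀ s, HasDerivAt G (C * f (v s)) s := fun s =>
    intervalIntegral.integral_hasDerivAt_right (hgc.intervalIntegrable _ _)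
      hgc.stronglyMeasurable.stronglyMeasurableAtFilter hgc.continuousAt
  have hGpos : ∀ s, 0 < s → 0 < G s := fun s hs =>
    intervalIntegral.intervalIntegral_pos_of_pos (hgc.intervalIntegrable _ _) hgpos hs
  have hG0 : G 0 = 0 := by simp [hG]
  have hηpos : ∀ y, 0 < y → 0 < η y := fun y hy => (hη0 y).lt_of_ne' fun he => by
    have := hhη y hy.le
    rw [he, hh0] at this
    exact hy.ne this
  have hη00 : η 0 = 0 := by
    by_contra hne
    have := hhpos _ ((hη0 0).lt_of_ne' hne)
    rw [hhη 0 le_rfl] at this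
    exact lt_irrefl _ this
  have hFd : ∀ t, HasDerivAt (fun t => ∫ s in (0 : ℝ)..t, f s) (f t) t := fun t =>
    intervalIntegral.integral_hasDerivAt_right (hf.intervalIntegrable _ _)
      hf.stronglyMeasurable.stronglyMeasurableAtFilter hf.continuousAt
  have hΦd : Continuous fun t => ∫ s in (0 : ℝ)..t, h s :=
    intervalIntegral.continuous_primitive (fun a b => hh.intervalIntegrable a b) 0
  have hGc : Continuous G := continuous_iff_continuousAt.2 fun s => (hGd s).continuousAt
  have hzc : Continuous z := continuous_iff_continuousAt.2 fun s => (hz s).continuousAt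
  have hFc : Continuous fun t => ∫ s in (0 : ℝ)..t, f s :=
    continuous_iff_continuousAt.2 fun s => (hFd s).continuousAt
  have hFnn : ∀ t, 0 ≤ t → 0 ≤ ∫ s in (0 : ℝ)..t, f s := fun t ht =>
    intervalIntegral.integral_nonneg ht fun s _ => hf0 s
  let Ψ : ℝ → ℝ := fun y => y * η y - ∫ s in (0 : ℝ)..η y, h s
  have hΨc : Continuous Ψ := (continuous_id.mul hη).sub (hΦd.comp hη)
  have hmono : MonotoneOn (fun s => C * (∫ t in (0 : ℝ)..z s, f t) - Ψ (G s)) (Icc 0 R) := by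
    refine monotoneOn_of_hasDerivWithinAt_nonneg (convex_Icc 0 R)
      (f' := fun s => C * (f (z s) * η (G s)) - η (G s) * (C * f (v s))) ?_ ?_ ?_
    · exact ((continuous_const.mul (hFc.comp hzc)).sub (hΨc.comp hGc)).continuousOn
    · intro s hs
      rw [interior_Icc] at hs
      obtain ⟨d, hd0, hd'⟩ := hd _ (hηpos _ (hGpos s hs.1))
      have h1 := (hasDerivAt_legendre hh hη hhη (hGpos s hs.1) hd' hd0).comp s (hGd s)
      have h2 := (((hFd (z s)).comp s (hz s)).const_mul C)
      exact (h2.sub h1).hasDerivWithinAt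
    · intro s hs
      rw [interior_Icc] at hs
      have := hfm (hvz s ⟨hs.1.le, hs.2.le⟩)
      have : C * (f (z s) * η (G s)) - η (G s) * (C * f (v s)) =
        C * η (G s) * (f (z s) - f (v s)) := by ring
      rw [this]
      exact mul_nonneg (mul_nonneg hC.le (hη0 _)) (by linarith)
  have hE := hmono ⟨le_rfl, hs.1.trans hs.2⟩ hs hs.1
  have hΨ0 : Ψ 0 = 0 := by simp [Ψ, hη00]
  simp only [hG0, hΨ0, hz0, sub_zero] at hE
  have hE0 : 0 ≤ C * ∫ t in (0 : ℝ)..α, f t := mul_nonneg hC.le (hFnn α hα.le)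
  have hzpos : 0 ≤ z s := hα.le.trans ((hvα s).trans (hvz s hs))
  have hGs : 0 ≤ G s := intervalIntegral.integral_nonneg hs.1 fun t _ => (hgpos t).le
  have hΨge : (l - 1) * ∫ t in (0 : ℝ)..η (G s), h t ≤ Ψ (G s) := by
    have := hlΦ (η (G s)) (hη0 _)
    rw [hhη _ hGs] at this
    simp only [Ψ]
    linarith
  have hF := hFnn (z s) hzpos
  have h3 : ∫ t in (0 : ℝ)..η (G s), h t ≤ K * ∫ t in (0 : ℝ)..z s, f t := by
    refine le_of_mul_le_mul_left ?_ (sub_pos.2 hl)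
    calc (l - 1) * ∫ t in (0 : ℝ)..η (G s), h t ≤ C * ∫ t in (0 : ℝ)..z s, f t := by linarith
      _ ≤ ((l - 1) * K) * ∫ t in (0 : ℝ)..z s, f t := mul_le_mul_of_nonneg_right hK hF
      _ = _ := by ring
  have h4 := mul_primitive_le hh hhm hK1 (hΦi0 _ hF)
  rw [hΦi _ hF] at h4
  exact ((strictMonoOn_primitive hh hhpos).le_iff_le (hη0 _)
    (mul_nonneg (by linarith) (hΦi0 _ hF))).1 (h3.trans h4)

/-- A priori bound for subsolutions when the Keller–Osserman integral diverges. -/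
theorem subsolution_bound (hh : Continuous h) (hhm : Monotone h) (hh0 : h 0 = 0)
    (hhpos : ∀ t, 0 < t → 0 < h t) (hd : ∀ t, 0 < t → ∃ d, d ≠ 0 ∧ HasDerivAt h d t)
    (hη : Continuous η) (hηm : Monotone η) (hη0 : ∀ y, 0 ≤ η y)
    (hhη : ∀ y, 0 ≤ y → h (η y) = y)
    (hl : 1 < l) (hlΦ : ∀ t, 0 ≤ t → l * ∫ s in (0 : ℝ)..t, h s ≤ t * h t)
    (hΦic : Continuous Φi) (hΦi0 : ∀ y, 0 ≤ y → 0 ≤ Φi y)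
    (hΦi : ∀ y, 0 ≤ y → ∫ s in (0 : ℝ)..Φi y, h s = y)
    (hf : Continuous f) (hfm : Monotone f) (hf0 : ∀ y, 0 ≤ f y) (hfpos : ∀ y, 0 < y → 0 < f y)
    (hρ : Continuous ρ) (hα : 0 < α)
    (hKO : ¬ IntegrableOn (fun t => 1 / Φi (∫ s in (0 : ℝ)..t, f s)) (Ioi 1))
    {R : ℝ} (hR : 0 < R) :
    ∃ B, ∀ v : ℝ → ℝ, Continuous v → (∀ r, α ≤ v r) →
      (∀ r, v r ≤ radialOperator N η f ρ α v r) → ∀ r ≤ R, v r ≤ B := by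
  obtain ⟨C₀, hC₀⟩ := isCompact_Icc.exists_bound_of_continuousOn (hρ.continuousOn (s := Icc 0 R))
  set C := max C₀ 1 with hCdef
  have hC : 0 < C := lt_max_of_lt_right one_pos
  have hCρ : ∀ t ∈ Icc 0 R, ρ t ≤ C := fun t ht =>
    (le_abs_self _).trans ((hC₀ t ht).trans (le_max_left _ _))
  set K := max 1 (C / (l - 1)) with hKdef
  have hK1 : 1 ≤ K := le_max_left _ _
  have hK : C ≤ (l - 1) * K := by
    rw [mul_comm, ← div_le_iff₀ (sub_pos.2 hl)]; exact le_max_right _ _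
  have hFc : Continuous fun t => ∫ s in (0 : ℝ)..t, f s :=
    intervalIntegral.continuous_primitive (fun a b => hf.intervalIntegrable a b) 0
  have hFpos : ∀ t, 0 < t → 0 < ∫ s in (0 : ℝ)..t, f s := fun t ht =>
    intervalIntegral.intervalIntegral_pos_of_pos_on (hf.intervalIntegrable _ _)
      (fun s hs => hfpos s hs.1) ht
  have hppos : ∀ t, 0 < t → 0 < Φi (∫ s in (0 : ℝ)..t, f s) := fun t ht =>
    (hΦi0 _ (hFpos t ht).le).lt_of_ne' fun he => by
      have := hΦi _ (hFpos t ht).le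
      rw [he, intervalIntegral.integral_same] at this
      exact (hFpos t ht).ne this
  set p : ℝ → ℝ := fun t => 1 / Φi (∫ s in (0 : ℝ)..t, f s) with hp
  have hpc : ContinuousOn p (Ioi 0) :=
    continuousOn_const.div (hΦic.comp hFc).continuousOn fun t ht => (hppos t ht).ne'
  have hpi : ∀ a b, 0 < a → 0 < b → IntervalIntegrable p volume a b := fun a b ha hb =>
    (hpc.mono fun t ht => (lt_min ha hb).trans_le ht.1).intervalIntegrable
  have hpp : ∀ t, 0 < t → 0 < p t := fun t ht => one_div_pos.2 (hppos t ht)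
  have hPd : ∀ t, 0 < t → HasDerivAt (fun t => ∫ s in (1 : ℝ)..t, p s) (p t) t := fun t ht =>
    intervalIntegral.integral_hasDerivAt_right (hpi 1 t one_pos ht)
      (hpc.stronglyMeasurableAtFilter isOpen_Ioi t ht) (hpc.continuousAt (Ioi_mem_nhds ht))
  obtain ⟨T, hT1, hT⟩ := exists_lt_integral_of_not_integrableOn
    (hpc.mono fun t (ht : 1 ≤ t) => one_pos.trans_le ht)
    (fun t ht => (hpp t (one_pos.trans_le ht)).le) hKO ((∫ s in (1 : ℝ)..α, p s) + K * R)
  refine ⟨T, fun v hv hvα hvT => ?_⟩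
  have hgc : Continuous fun t => C * f (v t) := by fun_prop
  have hGc : Continuous fun s => η (∫ t in (0 : ℝ)..s, C * f (v t)) :=
    hη.comp (intervalIntegral.continuous_primitive (fun a b => hgc.intervalIntegrable a b) 0)
  set z : ℝ → ℝ := fun r => α + ∫ s in (0 : ℝ)..r, η (∫ t in (0 : ℝ)..s, C * f (v t)) with hzdef
  have hz : ∀ s, HasDerivAt z (η (∫ t in (0 : ℝ)..s, C * f (v t))) s := fun s =>
    (intervalIntegral.integral_hasDerivAt_right (hGc.intervalIntegrable _ _)
      hGc.stronglyMeasurable.stronglyMeasurableAtFilter hGc.continuousAt).const_add α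
  have hz0 : z 0 = α := by simp [hzdef]
  have hzm : Monotone z := monotone_of_hasDerivAt_nonneg hz fun s => hη0 _
  have hTz : ∀ r ≤ R, v r ≤ z (max r 0) := fun r hr => by
    refine (hvT r).trans (add_le_add_right (intervalIntegral.integral_mono_on (le_max_right _ _)
      ((continuous_radialIntegrand hη hf hρ hv).intervalIntegrable _ _)
      (hGc.intervalIntegrable _ _) fun s hs => hηm ?_) α)
    have hsR : s ≤ R := hs.2.trans (max_le hr hR.le)
    refine le_trans (mul_le_mul_of_nonneg_left (dilationMean_mono N (by fun_prop) hgc hs.1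
      fun t ht => ?_) hs.1) (mul_dilationMean_le_integral N hgc hs.1
        fun t _ => mul_nonneg hC.le (hf0 _))
    exact mul_le_mul_of_nonneg_right (hCρ t ⟨ht.1, ht.2.trans hsR⟩) (hf0 _)
  have hvz : ∀ s ∈ Icc 0 R, v s ≤ z s := fun s hs => by
    have := hTz s hs.2
    rwa [max_eq_left hs.1] at this
  have hzpos : ∀ s, 0 ≤ s → 0 < z s := fun s hs => hα.trans_le (hz0 ▸ hzm hs)
  have hanti : AntitoneOn (fun s => (∫ t in (1 : ℝ)..z s, p t) - K * s) (Icc 0 R) := by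
    have hder : ∀ s ∈ Icc 0 R, HasDerivAt (fun s => (∫ t in (1 : ℝ)..z s, p t) - K * s)
        (p (z s) * η (∫ t in (0 : ℝ)..s, C * f (v t)) - K) s := fun s hs => by
      have h1 := (hPd (z s) (hzpos s hs.1)).comp s (hz s)
      have h2 := (hasDerivAt_id s).const_mul K
      rw [mul_one] at h2
      exact h1.sub h2
    refine antitoneOn_of_hasDerivWithinAt_nonpos (convex_Icc 0 R)
      (fun s hs => (hder s hs).continuousAt.continuousWithinAt)
      (fun s hs => (hder s (interior_subset hs)).hasDerivWithinAt) fun s hs => ?_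
    have hs' := interior_subset hs
    have := deriv_le_of_energy hh hhm hh0 hhpos hd hη hη0 hhη hl hlΦ hΦi0 hΦi hf hfm hf0 hfpos
      hα hC hK1 hK hv hvα hz0 hz hvz hs'
    have hq := hppos (z s) (hzpos s hs'.1)
    simp only [hp]
    rw [sub_nonpos, one_div_mul_eq_div, div_le_iff₀ hq]
    exact this
  have hfin := hanti ⟨le_rfl, hR.le⟩ ⟨hR.le, le_rfl⟩ hR.le
  simp only [hz0, mul_zero, sub_zero] at hfin
  have hzR : z R ≤ T := by
    by_contra! hlt
    have : 0 ≤ ∫ t in T..z R, p t := intervalIntegral.integral_nonneg hlt.le fun t ht =>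
      (hpp t (one_pos.trans_le (hT1.trans ht.1))).le
    have hadd := intervalIntegral.integral_add_adjacent_intervals
      (hpi 1 T one_pos (one_pos.trans_le hT1)) (hpi T (z R) (one_pos.trans_le hT1) (hzpos R hR.le))
    linarith
  exact fun r hr => (hTz r hr).trans ((hzm (max_le hr hR.le)).trans hzR)

end Bound

section Inverse

theorem continuous_comp_max_of_monotoneOn {g k : ℝ → ℝ} (hg : MonotoneOn g (Ici 0)) (hg0 : g 0 = 0)
    (hk : ∀ y, 0 ≤ y → 0 ≤ k y) (hgk : ∀ y, 0 ≤ y → g (k y) = y) :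
    Continuous (fun t => g (max t 0)) := by
  have hm : Monotone fun t : ℝ => g (max t 0) + min t 0 := fun a b hab =>
    add_le_add (hg (mem_Ici.2 (le_max_right _ _)) (mem_Ici.2 (le_max_right _ _)) (max_le_max_right 0 hab))
      (min_le_min_right 0 hab)
  have hs : Function.Surjective fun t : ℝ => g (max t 0) + min t 0 := fun y => by
    rcases le_total 0 y with hy | hy
    · exact ⟨k y, by simp [max_eq_left (hk y hy), min_eq_right (hk y hy), hgk y hy]⟩
    · exact ⟨y, by simp [max_eq_right hy, min_eq_left hy, hg0]⟩
  have hc := (hm.continuous_of_surjective hs).sub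
    (continuous_id.min (continuous_const (y := (0 : ℝ))))
  refine hc.congr fun t => ?_
  simp

theorem monotoneOn_inverse {g k : ℝ → ℝ} (hg : StrictMonoOn g (Ici 0))
    (hk : ∀ y, 0 ≤ y → 0 ≤ k y) (hgk : ∀ y, 0 ≤ y → g (k y) = y) : MonotoneOn k (Ici 0) :=
  fun a ha b hb hab => (hg.le_iff_le (hk a ha) (hk b hb)).1 (by rwa [hgk a ha, hgk b hb])

theorem MonotoneOn.comp_max_zero {g : ℝ → ℝ} (hg : MonotoneOn g (Ici 0)) :
    Monotone fun t => g (max t 0) :=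
  fun _ _ hab => hg (mem_Ici.2 (le_max_right _ _)) (mem_Ici.2 (le_max_right _ _)) (max_le_max_right 0 hab)

/-- If `h` grows at least like a power, then its inverse `η` satisfies a reverse `Δ₂` condition. -/
theorem exists_mul_le_inverse_mul {h h' η : ℝ → ℝ} {p c : ℝ} (hp : 0 < p) (hh0 : h 0 = 0)
    (hhη : ∀ y, 0 ≤ y → h (η y) = y) (hη0 : ∀ y, 0 ≤ η y) (hsm : StrictMonoOn h (Ici 0))
    (hd : ∀ t, 0 < t → HasDerivAt h (h' t) t) (hpow : ∀ t, 0 < t → p * h t ≤ h' t * t)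
    (hc : 0 < c) (hc1 : c ≤ 1) : ∃ κ, 0 < κ ∧ ∀ y, 0 ≤ y → κ * η y ≤ η (c * y) := by
  have hmono : MonotoneOn (fun t => t ^ (-p) * h t) (Ioi 0) := by
    have hder : ∀ t ∈ Ioi (0 : ℝ), HasDerivAt (fun t => t ^ (-p) * h t)
        (-p * t ^ (-p - 1) * h t + t ^ (-p) * h' t) t := fun t ht =>
      (Real.hasDerivAt_rpow_const (Or.inl (ne_of_gt ht))).mul (hd t ht)
    refine monotoneOn_of_hasDerivWithinAt_nonneg (convex_Ioi 0)
      (fun t ht => (hder t ht).continuousAt.continuousWithinAt)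
      (fun t ht => (hder t (interior_subset ht)).hasDerivWithinAt) fun t ht => ?_
    have ht0 : 0 < t := interior_subset ht
    have hpt := hpow t ht0
    have e : t ^ (-p) = t ^ (-p - 1) * t := by
      rw [← Real.rpow_add_one ht0.ne']; congr 1; ring
    rw [e]
    have : 0 < t ^ (-p - 1) := Real.rpow_pos_of_pos ht0 _
    nlinarith
  refine ⟨c ^ p⁻¹, Real.rpow_pos_of_pos hc _, fun y hy => ?_⟩
  set κ := c ^ p⁻¹ with hκ
  have hκ0 : 0 < κ := Real.rpow_pos_of_pos hc _
  have hκ1 : κ ≤ 1 := Real.rpow_le_one hc.le hc1 (by positivity)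
  have hκp : κ ^ p = c := by rw [hκ, ← Real.rpow_mul hc.le, inv_mul_cancel₀ hp.ne', Real.rpow_one]
  have hcy : 0 ≤ c * y := by positivity
  refine (hsm.le_iff_le (mul_nonneg hκ0.le (hη0 y)) (hη0 _)).1 ?_
  rw [hhη _ hcy]
  rcases (hη0 y).eq_or_lt with he | hpos
  · rw [← he, mul_zero, hh0]; exact hcy
  · have hm := hmono (mul_pos hκ0 hpos) hpos (mul_le_of_le_one_left hpos.le hκ1)
    simp only [hhη y hy, Real.mul_rpow hκ0.le hpos.le] at hm
    have hpp : 0 < η y ^ (-p) := Real.rpow_pos_of_pos hpos _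
    rw [Real.rpow_neg hκ0.le, hκp, mul_comm c⁻¹, mul_assoc] at hm
    have := le_of_mul_le_mul_left hm hpp
    rwa [inv_mul_le_iff₀ hc] at this

end Inverse

section Flux

variable {N : ℕ}

theorem integral_flux_add_integral_eq_zero (hN : 1 ≤ N) {φ q W W' : ℝ → ℝ} (hq : Continuous q)
    (hW : ∀ r, HasDerivAt W (W' r) r) (hW0 : W' 0 = 0) (hW'0 : ∀ r, 0 ≤ r → 0 ≤ W' r)
    (hflux : ∀ r, 0 < r → φ (W' r) * W' r = r * dilationMean N q r)
    {ψ : EuclideanSpace ℝ (Fin N) → ℝ} (hψ : ContDiff ℝ 1 ψ) (hc : HasCompactSupport ψ) :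
    (∫ x : EuclideanSpace ℝ (Fin N),
      φ ‖gradient (fun y : EuclideanSpace ℝ (Fin N) => W ‖y‖) x‖ *
        ⟪gradient (fun y : EuclideanSpace ℝ (Fin N) => W ‖y‖) x, gradient ψ x⟫) +
      (∫ x : EuclideanSpace ℝ (Fin N), q ‖x‖ * ψ x) = 0 := by
  have key := integral_dilation_mean_mul_fderiv (volume : Measure (EuclideanSpace ℝ (Fin N)))
    (q := fun x => q ‖x‖) (by simpa using hN) (hq.comp continuous_norm) hψ hc
  rw [← eq_neg_iff_add_eq_zero, ← key]
  refine integral_congr_ae (Eventually.of_forall fun x => ?_)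
  have hinner : ∀ y, ⟪y, gradient ψ x⟫ = fderiv ℝ ψ x y := fun y => by
    rw [real_inner_comm, gradient, InnerProductSpace.toDual_symm_apply]
  have hmean : ∫ τ in (0 : ℝ)..1,
      τ ^ (Module.finrank ℝ (EuclideanSpace ℝ (Fin N)) - 1) * q ‖τ • x‖ =
      dilationMean N q ‖x‖ := by
    refine intervalIntegral.integral_congr fun τ hτ => ?_
    rw [uIcc_of_le zero_le_one] at hτ
    simp [norm_smul, abs_of_nonneg hτ.1]
  simp only [hmean, (hasGradientAt_radial hW hW0 x).gradient]
  rw [real_inner_smul_left, hinner]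
  rcases eq_or_ne x 0 with rfl | hx
  · simp
  · have hr : 0 < ‖x‖ := norm_pos_iff.2 hx
    have hn : ‖(W' ‖x‖ / ‖x‖) • x‖ = W' ‖x‖ := by
      rw [norm_smul, norm_div, norm_norm, div_mul_cancel₀ _ hr.ne',
        Real.norm_of_nonneg (hW'0 _ hr.le)]
    rw [hn, ← mul_assoc, ← mul_div_assoc, hflux _ hr, mul_div_cancel_left₀ _ hr.ne']

end Flux

/-- Lemma 5.1: under (φ₁)-(φ₃), if ρ ≥ 0 is continuous and
satisfies (A_ρ): ∫₁^∞ h⁻¹(𝒜_ρ(s)) ds = ∞ with 𝒜_ρ(s) = s^{1−N}∫₀^s t^{N−1}ρ(t)dt,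
and f is continuous, non-decreasing, f(0) = 0, f > 0 on (0,∞) and fails the
φ-Keller–Osserman condition, then for every α > 0 there is a positive radial
solution u(x) = w(|x|) ∈ C¹(ℝᴺ) of Δ_φ u = ρ(|x|)f(u) in ℝᴺ with u(0) = α and
u(x) → ∞ as |x| → ∞. -/
theorem stmt15
    (N : ℕ) (hN : 1 ≤ N)
    (φ Φ Φinv hfun hinv : ℝ → ℝ)
    (hφC1 : ContDiffOn ℝ 1 φ (Set.Ioi 0))
    (hφpos : ∀ t > (0:ℝ), 0 < φ t)
    (hΦ : ∀ t : ℝ, Φ t = ∫ s in (0:ℝ)..|t|, φ s * s)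
    (hφ1 : ∀ t > (0:ℝ), 0 < deriv (fun s => φ s * s) t)
    (l m l₁ m₁ : ℝ) (hl : 1 < l) (hm : 1 < m)
    (hφ2 : ∀ t > (0:ℝ), l ≤ φ t * t ^ 2 / Φ t ∧ φ t * t ^ 2 / Φ t ≤ m)
    (hl₁ : 0 < l₁) (hm₁ : 0 < m₁)
    (hφ3 : ∀ t > (0:ℝ), l₁ ≤ deriv (fun s => φ s * s) t * t / (φ t * t) ∧
      deriv (fun s => φ s * s) t * t / (φ t * t) ≤ m₁)
    (hΦinv_nonneg : ∀ t ≥ (0:ℝ), 0 ≤ Φinv t)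
    (hΦinv_left : ∀ t ≥ (0:ℝ), Φinv (Φ t) = t)
    (hΦinv_right : ∀ t ≥ (0:ℝ), Φ (Φinv t) = t)
    (hh0 : hfun 0 = 0)
    (hhdef : ∀ t > (0:ℝ), hfun t = φ t * t)
    (hinv_nonneg : ∀ t ≥ (0:ℝ), 0 ≤ hinv t)
    (hinv_left : ∀ t ≥ (0:ℝ), hinv (hfun t) = t)
    (hinv_right : ∀ t ≥ (0:ℝ), hfun (hinv t) = t)
    (ρ : ℝ → ℝ)
    (hρ_cont : ContinuousOn ρ (Set.Ici 0))
    (hρ_nonneg : ∀ r ≥ (0:ℝ), 0 ≤ ρ r)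
    (hAρ : ¬ IntegrableOn
      (fun s => hinv (s ^ ((1:ℝ) - N) * ∫ t in (0:ℝ)..s, t ^ (N - 1) * ρ t))
      (Set.Ioi 1))
    (f : ℝ → ℝ)
    (hf_cont : ContinuousOn f (Set.Ici 0))
    (hf0 : f 0 = 0)
    (hf_pos : ∀ s > (0:ℝ), 0 < f s)
    (hf_mono : MonotoneOn f (Set.Ici 0))
    (hKO_fail : ¬ IntegrableOn (fun t => 1 / Φinv (∫ s in (0:ℝ)..t, f s)) (Set.Ioi 1)) :
    ∀ α > (0:ℝ), ∃ w : ℝ → ℝ,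
      ContDiff ℝ 1 (fun x : EuclideanSpace ℝ (Fin N) => w ‖x‖) ∧
      (∀ x : EuclideanSpace ℝ (Fin N), 0 < w ‖x‖) ∧
      w 0 = α ∧
      (∀ ψ : EuclideanSpace ℝ (Fin N) → ℝ, ContDiff ℝ (⊤ : ℕ∞) ψ → HasCompactSupport ψ →
        (∫ x : EuclideanSpace ℝ (Fin N),
            φ ‖gradient (fun y : EuclideanSpace ℝ (Fin N) => w ‖y‖) x‖ *
              ⟪gradient (fun y : EuclideanSpace ℝ (Fin N) => w ‖y‖) x, gradient ψ x⟫) +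
          (∫ x : EuclideanSpace ℝ (Fin N), ρ ‖x‖ * f (w ‖x‖) * ψ x) = 0) ∧
      (∀ M : ℝ, ∃ R : ℝ, ∀ x : EuclideanSpace ℝ (Fin N), R < ‖x‖ → M < w ‖x‖) := by
  intro α hα
  have hderiv : ∀ t, 0 < t → HasDerivAt (fun s => φ s * s) (deriv (fun s => φ s * s) t) t :=
    fun t ht => ((((hφC1.contDiffAt (Ioi_mem_nhds ht)).differentiableAt (by norm_num)).mul
      differentiableAt_id)).hasDerivAt
  have hsm : StrictMonoOn hfun (Ici 0) := by
    have h1 : StrictMonoOn (fun s => φ s * s) (Ioi 0) :=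
      strictMonoOn_of_deriv_pos (convex_Ioi 0)
        (fun t ht => (hderiv t ht).continuousAt.continuousWithinAt)
        fun t ht => hφ1 t (interior_subset ht)
    intro a ha b _ hab
    have hb : 0 < b := lt_of_le_of_lt ha hab
    rcases (show 0 ≤ a from ha).eq_or_lt with rfl | ha
    · rw [hh0, hhdef b hb]; exact mul_pos (hφpos b hb) hb
    · rw [hhdef a ha, hhdef b hb]; exact h1 ha hb hab
  set h : ℝ → ℝ := fun t => hfun (max t 0) with hhd
  have heq : ∀ t, 0 ≤ t → h t = hfun t := fun t ht => by simp only [hhd, max_eq_left ht]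
  have hfun_nonneg : ∀ t, 0 ≤ t → 0 ≤ hfun t := fun t ht => by
    have := hsm.monotoneOn self_mem_Ici ht ht
    rwa [hh0] at this
  have hinv0 : hinv 0 = 0 := by simpa [hh0] using hinv_left 0 le_rfl
  have hkm := monotoneOn_inverse hsm hinv_nonneg hinv_right
  set η : ℝ → ℝ := fun y => hinv (max y 0) with hηd
  have hhc : Continuous h :=
    continuous_comp_max_of_monotoneOn hsm.monotoneOn hh0 hinv_nonneg hinv_right
  have hηc : Continuous η := continuous_comp_max_of_monotoneOn hkm hinv0 hfun_nonneg hinv_left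
  have hhm : Monotone h := hsm.monotoneOn.comp_max_zero
  have hηm : Monotone η := hkm.comp_max_zero
  have hη0 : ∀ y, 0 ≤ η y := fun y => hinv_nonneg _ (le_max_right _ _)
  have hhη : ∀ y, 0 ≤ y → h (η y) = y := fun y hy => by
    rw [heq _ (hη0 y)]; simp only [hηd, max_eq_left hy]; exact hinv_right y hy
  have hh00 : h 0 = 0 := by simp [hhd, hh0]
  have hhφ : ∀ t, 0 < t → h t = φ t * t := fun t ht => by rw [heq t ht.le, hhdef t ht]
  have hhpos : ∀ t, 0 < t → 0 < h t := fun t ht => by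
    rw [hhφ t ht]; exact mul_pos (hφpos t ht) ht
  have hhderiv : ∀ t, 0 < t → HasDerivAt h (deriv (fun s => φ s * s) t) t := fun t ht =>
    (hderiv t ht).congr_of_eventuallyEq (by filter_upwards [lt_mem_nhds ht] with s hs using hhφ s hs)
  have hΦh : ∀ t, 0 ≤ t → ∫ s in (0 : ℝ)..t, h s = Φ t := fun t ht => by
    rw [hΦ t, abs_of_nonneg ht]
    refine intervalIntegral.integral_congr fun s hs => ?_
    rw [uIcc_of_le ht] at hs
    rcases hs.1.eq_or_lt with rfl | hs0
    · simp [hh00]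
    · exact hhφ s hs0
  have hΦsm : StrictMonoOn Φ (Ici 0) := (strictMonoOn_primitive hhc hhpos).congr fun t ht => hΦh t ht
  have hΦ0 : Φ 0 = 0 := by rw [← hΦh 0 le_rfl]; simp
  have hΦpos : ∀ t, 0 < t → 0 < Φ t := fun t ht => by
    have := hΦsm self_mem_Ici ht.le ht
    rwa [hΦ0] at this
  have hΦnn : ∀ t, 0 ≤ t → 0 ≤ Φ t := fun t ht => by
    have := hΦsm.monotoneOn self_mem_Ici ht ht
    rwa [hΦ0] at this
  have hlΦ : ∀ t, 0 ≤ t → l * ∫ s in (0 : ℝ)..t, h s ≤ t * h t := fun t ht => by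
    rw [hΦh t ht]
    rcases ht.eq_or_lt with rfl | ht
    · simp [hΦ0]
    · have := (hφ2 t ht).1
      rw [le_div_iff₀ (hΦpos t ht)] at this
      rw [hhφ t ht]
      linarith
  set Φi : ℝ → ℝ := fun y => Φinv (max y 0) with hΦid
  have hΦic : Continuous Φi := continuous_comp_max_of_monotoneOn
    (monotoneOn_inverse hΦsm hΦinv_nonneg hΦinv_right)
    (by simpa [hΦ0] using hΦinv_left 0 le_rfl) hΦnn hΦinv_left
  have hΦi0 : ∀ y, 0 ≤ y → 0 ≤ Φi y := fun y _ => hΦinv_nonneg _ (le_max_right _ _)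
  have hΦi : ∀ y, 0 ≤ y → ∫ s in (0 : ℝ)..Φi y, h s = y := fun y hy => by
    rw [hΦh _ (hΦi0 y hy)]; simp only [hΦid, max_eq_left hy]; exact hΦinv_right y hy
  set f' : ℝ → ℝ := fun t => f (max t 0) with hf'd
  set ρ' : ℝ → ℝ := fun t => ρ (max t 0) with hρ'd
  have hmaxc : Continuous fun t : ℝ => max t 0 := continuous_id.max continuous_const
  have hf'c : Continuous f' := hf_cont.comp_continuous hmaxc fun t => mem_Ici.2 (le_max_right _ _)
  have hρ'c : Continuous ρ' := hρ_cont.comp_continuous hmaxc fun t => mem_Ici.2 (le_max_right _ _)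
  have hf'eq : ∀ t, 0 ≤ t → f' t = f t := fun t ht => by simp only [hf'd, max_eq_left ht]
  have hρ'eq : ∀ t, 0 ≤ t → ρ' t = ρ t := fun t ht => by simp only [hρ'd, max_eq_left ht]
  have hf'm : Monotone f' := hf_mono.comp_max_zero
  have hf'pos : ∀ t, 0 < t → 0 < f' t := fun t ht => by rw [hf'eq t ht.le]; exact hf_pos t ht
  have hf'0 : ∀ t, 0 ≤ f' t := fun t => by
    have := hf_mono self_mem_Ici (mem_Ici.2 (le_max_right t 0)) (le_max_right t 0)
    rwa [hf0] at this
  have hρ'0 : ∀ t, 0 ≤ ρ' t := fun t => hρ_nonneg _ (le_max_right _ _)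
  have hKO : ¬ IntegrableOn (fun t => 1 / Φi (∫ s in (0 : ℝ)..t, f' s)) (Ioi 1) := by
    intro hcon
    refine hKO_fail (hcon.congr_fun (fun t ht => ?_) measurableSet_Ioi)
    have ht0 : (0 : ℝ) ≤ t := zero_le_one.trans (le_of_lt ht)
    have he : ∫ s in (0 : ℝ)..t, f' s = ∫ s in (0 : ℝ)..t, f s :=
      intervalIntegral.integral_congr fun s hs => by
        rw [uIcc_of_le ht0] at hs
        exact hf'eq s hs.1
    have hnn : 0 ≤ ∫ s in (0 : ℝ)..t, f' s := intervalIntegral.integral_nonneg ht0 fun s _ => hf'0 s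
    rw [he] at hnn
    simp only [hΦid, he, max_eq_left hnn]
  obtain ⟨w, hwc, hwα, hw⟩ := exists_fixedPoint_radialOperator (N := N) (α := α) hηc hf'c hρ'c hηm
    hf'm hρ'0 hη0 hf'0 fun R hR => subsolution_bound hhc hhm hh00 hhpos
      (fun t ht => ⟨_, (hφ1 t ht).ne', hhderiv t ht⟩) hηc hηm hη0 hhη hl hlΦ hΦic hΦi0 hΦi hf'c hf'm
      hf'0 hf'pos hρ'c hα hKO hR
  set q : ℝ → ℝ := fun t => ρ' t * f' (w t) with hqd
  have hqc : Continuous q := hρ'c.mul (hf'c.comp hwc)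
  have hq0 : ∀ t, 0 ≤ q t := fun t => mul_nonneg (hρ'0 _) (hf'0 _)
  set W' : ℝ → ℝ := fun s => η (s * dilationMean N q s) with hW'd
  have hW'c : Continuous W' := hηc.comp (continuous_id.mul (continuous_dilationMean N hqc))
  set W : ℝ → ℝ := fun r => α + ∫ s in (0 : ℝ)..r, W' s with hWd
  have hW : ∀ r, HasDerivAt W (W' r) r := fun r =>
    (intervalIntegral.integral_hasDerivAt_right (hW'c.intervalIntegrable _ _)
      hW'c.stronglyMeasurable.stronglyMeasurableAtFilter hW'c.continuousAt).const_add α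
  have hWw : ∀ r, 0 ≤ r → W r = w r := fun r hr => by
    rw [hw r, radialOperator, max_eq_left hr]
  have hW'0 : W' 0 = 0 := by simp [hW'd, hηd, hinv0]
  have hWm : Monotone W := monotone_of_hasDerivAt_nonneg hW fun r => hη0 _
  have hdm : ∀ r, 0 ≤ r → 0 ≤ r * dilationMean N q r := fun r hr =>
    mul_nonneg hr (dilationMean_nonneg N hr fun t _ => hq0 t)
  refine ⟨W, contDiff_one_radial hW hW'c hW'0, fun x => ?_, by simp [hWd], fun ψ hψ hc => ?_, ?_⟩
  · rw [hWw _ (norm_nonneg x)]; exact hα.trans_le (hwα _)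
  · have hflux : ∀ r, 0 < r → φ (W' r) * W' r = r * dilationMean N q r := fun r hr => by
      have hy := hhη _ (hdm r hr.le)
      rcases (hη0 (r * dilationMean N q r)).eq_or_lt with he | hpos
      · rw [← he, hh00] at hy
        rw [show W' r = 0 from he.symm, mul_zero, ← hy]
      · rw [hhφ _ hpos] at hy
        exact hy
    have key := integral_flux_add_integral_eq_zero hN (φ := φ) hqc hW hW'0 (fun r _ => hη0 _) hflux
      (hψ.of_le (by exact_mod_cast le_top)) hc
    have he : ∀ x : EuclideanSpace ℝ (Fin N), ρ ‖x‖ * f (W ‖x‖) = q ‖x‖ := fun x => by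
      rw [hqd, hWw _ (norm_nonneg x), ← hρ'eq _ (norm_nonneg x),
        ← hf'eq _ (hα.le.trans (hwα ‖x‖))]
    simp only [he]
    exact key
  · intro M
    set c := min (f' α) 1 with hcd
    have hc : 0 < c := lt_min (hf'pos α hα) one_pos
    obtain ⟨κ, hκ, hκη⟩ := exists_mul_le_inverse_mul (h := h)
      (h' := deriv fun s => φ s * s) hl₁ hh00 hhη hη0
      (hsm.congr fun t ht => (heq t ht).symm) hhderiv (fun t ht => by
        have := (hφ3 t ht).1
        rw [le_div_iff₀ (mul_pos (hφpos t ht) ht)] at this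
        rwa [hhφ t ht]) hc (min_le_right _ _)
    set p : ℝ → ℝ := fun s => η (s * dilationMean N ρ' s) with hpd
    have hpc : Continuous p := hηc.comp (continuous_id.mul (continuous_dilationMean N hρ'c))
    have hpn : ¬ IntegrableOn p (Ioi 1) := by
      intro hcon
      refine hAρ (hcon.congr_fun (fun s hs => ?_) measurableSet_Ioi)
      have hs0 : (0 : ℝ) < s := zero_lt_one.trans hs
      have e := pow_mul_dilationMean hN ρ hs0
      have e' : dilationMean N ρ' s = dilationMean N ρ s := dilationMean_congr N hs0.le hρ'eq
      have hnn : 0 ≤ s * dilationMean N ρ' s :=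
        mul_nonneg hs0.le (dilationMean_nonneg N hs0.le fun t _ => hρ'0 t)
      simp only [hpd, hηd, max_eq_left hnn]
      rw [← e, ← mul_assoc, ← Real.rpow_natCast s N, ← Real.rpow_add hs0, e']
      simp
    obtain ⟨T, hT1, hT⟩ := exists_lt_integral_of_not_integrableOn hpc.continuousOn
      (fun t _ => hη0 _) hpn ((M - α) / κ)
    rw [div_lt_iff₀ hκ] at hT
    have hT0 : (0 : ℝ) ≤ T := zero_le_one.trans hT1
    refine ⟨T, fun x hx => lt_of_lt_of_le ?_ (hWm hx.le)⟩
    have h1 : ∫ s in (0 : ℝ)..T, κ * p s ≤ ∫ s in (0 : ℝ)..T, W' s := by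
      refine intervalIntegral.integral_mono_on hT0 ((hpc.const_mul κ).intervalIntegrable _ _)
        (hW'c.intervalIntegrable _ _) fun s hs => ?_
      refine (hκη _ (mul_nonneg hs.1 (dilationMean_nonneg N hs.1 fun t _ => hρ'0 t))).trans
        (hηm ?_)
      have h2 := dilationMean_mono N (hρ'c.const_mul c) hqc hs.1 fun t _ => by
        have h3 : c ≤ f' (w t) := (min_le_left _ _).trans (hf'm (hwα t))
        have := mul_le_mul_of_nonneg_left h3 (hρ'0 t)
        simp only [hqd]
        linarith
      rw [dilationMean_const_mul] at h2
      have := mul_le_mul_of_nonneg_left h2 hs.1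
      linarith
    have h4 : 0 ≤ ∫ s in (0 : ℝ)..1, p s :=
      intervalIntegral.integral_nonneg zero_le_one fun s _ => hη0 _
    have h5 := intervalIntegral.integral_add_adjacent_intervals
      (hpc.intervalIntegrable (μ := volume) 0 1) (hpc.intervalIntegrable 1 T)
    rw [intervalIntegral.integral_const_mul] at h1
    have h6 : W T = α + ∫ s in (0 : ℝ)..T, W' s := rfl
    rw [h6]
    nlinarith
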